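/- For every integer L ≥ 1, the following truncation of Gauss' square exponent theorem holds in ℚ(q): ∑_{k=-L}^{L-1} (-1)^k q^{k^2} (-q;q)_{L-k-1} [3L-k-1 choose L+k]_q · (1-q^{4L-1})/(1-q^{3L-k-1}) = 1. -/

import Mathlib

open Finset

/-- The indeterminate `q`, as an element of the field `ℚ(q)` of rational functions. -/
noncomputable def q : RatFunc ℚ := RatFunc.X

/-- The q-Pochhammer symbol `(a; q)_n` for a nonnegative integer `n`. -/
noncomputable def qPoch (a : RatFunc ℚ) (n : ℕ) : RatFunc ℚ :=
  ∏ k ∈ Finset.range n, (1 - a * q ^ k)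

/-- The q-Pochhammer symbol `(a; q)_n` for an arbitrary integer `n`, where for `n > 0`
`(a; q)_{-n} = 1 / (a q^{-n}; q)_n`. -/
noncomputable def qPochZ (a : RatFunc ℚ) (n : ℤ) : RatFunc ℚ :=
  if 0 ≤ n then qPoch a n.toNat else 1 / qPoch (a * q ^ n) (-n).toNat

/-- The Gaussian (q-)binomial coefficient `[n choose m]_q`, equal to
`(q;q)_n / ((q;q)_m (q;q)_{n-m})` for `0 ≤ m ≤ n` and `0` otherwise. -/
noncomputable def qbinom (n m : ℤ) : RatFunc ℚ :=
  if 0 ≤ m ∧ m ≤ n then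
    qPoch q n.toNat / (qPoch q m.toNat * qPoch q (n - m).toNat)
  else 0

lemma q_ne_zero : q ≠ 0 := RatFunc.X_ne_zero

lemma algebraMap_ne_zero_of_coeff_zero {f : Polynomial ℚ} (hf : f.coeff 0 ≠ 0) :
    algebraMap (Polynomial ℚ) (RatFunc ℚ) f ≠ 0 := by
  refine RatFunc.algebraMap_ne_zero ?_
  rintro rfl
  exact hf (Polynomial.coeff_zero 0)

lemma one_sub_q_pow_ne_zero (n : ℕ) : 1 - q ^ (n + 1) ≠ 0 := by
  have h := algebraMap_ne_zero_of_coeff_zero (f := 1 - Polynomial.X ^ (n + 1)) (by simp)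
  simpa [q] using h

lemma one_add_q_pow_ne_zero (n : ℕ) : 1 + q ^ (n + 1) ≠ 0 := by
  have h := algebraMap_ne_zero_of_coeff_zero (f := 1 + Polynomial.X ^ (n + 1)) (by simp)
  simpa [q] using h

lemma qPoch_succ (a : RatFunc ℚ) (n : ℕ) : qPoch a (n + 1) = qPoch a n * (1 - a * q ^ n) :=
  prod_range_succ _ _

lemma qPoch_q_ne_zero (n : ℕ) : qPoch q n ≠ 0 := by
  refine prod_ne_zero_iff.2 fun k _ => ?_
  rw [← pow_succ']
  exact one_sub_q_pow_ne_zero k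

/-- The reciprocal `1 / (q;q)_n`, with the convention that it vanishes for negative `n`. -/
noncomputable def qFactInv (n : ℤ) : RatFunc ℚ :=
  if 0 ≤ n then 1 / qPoch q n.toNat else 0

lemma qFactInv_natCast (n : ℕ) : qFactInv n = 1 / qPoch q n := by simp [qFactInv]

lemma qFactInv_of_neg {n : ℤ} (hn : n < 0) : qFactInv n = 0 := if_neg (by omega)

lemma qFactInv_sub_one (n : ℤ) : qFactInv (n - 1) = (1 - q ^ n) * qFactInv n := by
  rcases lt_trichotomy n 0 with hn | rfl | hn
  · rw [qFactInv_of_neg hn, qFactInv_of_neg (by omega), mul_zero]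
  · rw [qFactInv_of_neg (by omega)]
    simp
  · obtain ⟨m, rfl⟩ : ∃ m : ℕ, n = (m + 1 : ℕ) := ⟨(n - 1).toNat, by omega⟩
    have h : ((m + 1 : ℕ) : ℤ) - 1 = (m : ℕ) := by push_cast; ring
    have h1 := qPoch_q_ne_zero m
    have h2 := one_sub_q_pow_ne_zero m
    rw [h, qFactInv_natCast, qFactInv_natCast, qPoch_succ, ← pow_succ', zpow_natCast]
    field_simp

/-- The ratio `(-q;q)_i / (q;q)_{2i+1}`. -/
noncomputable def qPochRatio (i : ℕ) : RatFunc ℚ := qPoch (-q) i / qPoch q (2 * i + 1)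

lemma qPochRatio_succ (i : ℕ) :
    qPochRatio (i + 1) * ((1 - q * q ^ i) * (1 - q ^ 3 * (q ^ i) ^ 2)) = qPochRatio i := by
  have h0 := qPoch_q_ne_zero (2 * i + 1)
  have h1 : 1 - q * q ^ i ≠ 0 := by rw [← pow_succ']; exact one_sub_q_pow_ne_zero i
  have h2 : 1 + q * q ^ i ≠ 0 := by rw [← pow_succ']; exact one_add_q_pow_ne_zero i
  have h3 : 1 - q ^ 3 * (q ^ i) ^ 2 ≠ 0 := by
    convert one_sub_q_pow_ne_zero (2 * i + 2) using 2
    ring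
  have h4 : qPoch q (2 * (i + 1) + 1) = qPoch q (2 * i + 1) *
      ((1 - q * q ^ i) * (1 + q * q ^ i)) * (1 - q ^ 3 * (q ^ i) ^ 2) := by
    rw [show 2 * (i + 1) + 1 = 2 * i + 1 + 1 + 1 by ring, qPoch_succ, qPoch_succ]
    ring
  rw [qPochRatio, qPochRatio, h4, qPoch_succ]
  field_simp
  ring

/-- The summand of the finite sum, reindexed from the top and with a general parameter `p`. -/
noncomputable def gaussTerm (p i : ℕ) : RatFunc ℚ :=
  (-1) ^ i * q ^ ((i : ℤ) ^ 2 - ((p : ℤ) - 1) * i) * qPoch q (p + i) * qFactInv ((p : ℤ) - i) *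
    qPochRatio i

lemma gaussTerm_of_lt {p i : ℕ} (h : p < i) : gaussTerm p i = 0 := by
  rw [gaussTerm, qFactInv_of_neg (by omega)]
  ring

/-- The antidifference certifying the recurrence of `truncGaussSum` in `p`. -/
noncomputable def gaussCert (p i : ℕ) : RatFunc ℚ :=
  (-1) ^ i * q ^ ((i : ℤ) ^ 2 - ((p : ℤ) + 1) * i) * qPoch q (p + i) *
    qFactInv ((p : ℤ) + 2 - i) * qPochRatio i * ((1 - q ^ i) * (1 - q * (q ^ i) ^ 2))

lemma gaussTerm_telescope (p i : ℕ) :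
    -((1 - q * (q ^ p) ^ 2) * (1 + q ^ 2 * q ^ p)) * gaussTerm p i +
      q ^ p * ((1 - q) * (1 - q ^ 3 * (q ^ p) ^ 2)) * gaussTerm (p + 1) i -
      q ^ p * ((1 - q ^ 5 * (q ^ p) ^ 2) * (1 + q * q ^ p)) * gaussTerm (p + 2) i =
    q ^ p * ((1 + q * q ^ p) * (1 + q ^ 2 * q ^ p) * (1 - q ^ 3 * (q ^ p) ^ 2)) *
      (gaussCert p (i + 1) - gaussCert p i) := by
  have hq := q_ne_zero
  have hx : q ^ i ≠ 0 := pow_ne_zero _ hq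
  have hY : q ^ p ≠ 0 := pow_ne_zero _ hq
  have e0 : q ^ ((i : ℤ) ^ 2 - ((p : ℤ) - 1) * i) =
      q ^ ((i : ℤ) ^ 2 - ((p : ℤ) + 1) * i) * (q ^ i) ^ 2 := by
    rw [← pow_mul, ← zpow_natCast, ← zpow_add₀ hq]
    congr 1
    push_cast
    ring
  have e1 : q ^ ((i : ℤ) ^ 2 - (((p + 1 : ℕ) : ℤ) - 1) * i) =
      q ^ ((i : ℤ) ^ 2 - ((p : ℤ) + 1) * i) * q ^ i := by
    rw [← zpow_natCast q i, ← zpow_add₀ hq]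
    congr 1
    push_cast
    ring
  have e2 : q ^ ((i : ℤ) ^ 2 - (((p + 2 : ℕ) : ℤ) - 1) * i) =
      q ^ ((i : ℤ) ^ 2 - ((p : ℤ) + 1) * i) := by
    congr 1
    push_cast
    ring
  have e3 : q ^ (((i + 1 : ℕ) : ℤ) ^ 2 - ((p : ℤ) + 1) * ((i + 1 : ℕ) : ℤ)) =
      q ^ ((i : ℤ) ^ 2 - ((p : ℤ) + 1) * i) * ((q ^ i) ^ 2 / q ^ p) := by
    rw [← pow_mul, ← zpow_natCast, ← zpow_natCast q p, ← zpow_sub₀ hq, ← zpow_add₀ hq]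
    congr 1
    push_cast
    ring
  have p1 : qPoch q (p + 1 + i) = qPoch q (p + i) * (1 - q * (q ^ p * q ^ i)) := by
    rw [show p + 1 + i = p + i + 1 by ring, qPoch_succ, pow_add]
  have p2 : qPoch q (p + 2 + i) =
      qPoch q (p + i) * (1 - q * (q ^ p * q ^ i)) * (1 - q ^ 2 * (q ^ p * q ^ i)) := by
    rw [show p + 2 + i = p + i + 1 + 1 by ring, qPoch_succ, qPoch_succ]
    ring
  have p3 : qPoch q (p + (i + 1)) = qPoch q (p + i) * (1 - q * (q ^ p * q ^ i)) := by
    rw [← add_assoc, qPoch_succ, pow_add]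
  have z2 : q ^ ((p : ℤ) + 2 - i) = q ^ 2 * q ^ p / q ^ i := by
    rw [zpow_sub₀ hq, zpow_add₀ hq, zpow_natCast, zpow_natCast, mul_comm]
    norm_cast
  have z1 : q ^ ((p : ℤ) + 1 - i) = q * q ^ p / q ^ i := by
    rw [zpow_sub₀ hq, zpow_add₀ hq, zpow_natCast, zpow_natCast, mul_comm]
    norm_num
  have r1 : qFactInv ((p : ℤ) + 1 - i) =
      (1 - q ^ 2 * q ^ p / q ^ i) * qFactInv ((p : ℤ) + 2 - i) := by
    rw [← z2, ← qFactInv_sub_one]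
    congr 1
    ring
  have r0 : qFactInv ((p : ℤ) - i) =
      (1 - q * q ^ p / q ^ i) * (1 - q ^ 2 * q ^ p / q ^ i) * qFactInv ((p : ℤ) + 2 - i) := by
    rw [mul_assoc, ← r1, ← z1, ← qFactInv_sub_one]
    congr 1
    ring
  have r1' : qFactInv (((p + 1 : ℕ) : ℤ) - i) =
      (1 - q ^ 2 * q ^ p / q ^ i) * qFactInv ((p : ℤ) + 2 - i) := by
    rw [← r1]
    push_cast
    rfl
  have r2' : qFactInv (((p + 2 : ℕ) : ℤ) - i) = qFactInv ((p : ℤ) + 2 - i) := by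
    push_cast
    rfl
  have r3' : qFactInv ((p : ℤ) + 2 - ((i + 1 : ℕ) : ℤ)) =
      (1 - q ^ 2 * q ^ p / q ^ i) * qFactInv ((p : ℤ) + 2 - i) := by
    rw [← r1]
    congr 1
    push_cast
    ring
  simp only [gaussTerm, gaussCert]
  rw [e0, e1, e2, e3, p1, p2, p3, r0, r1', r2', r3', ← qPochRatio_succ i, pow_succ q i,
    pow_succ (-1 : RatFunc ℚ) i]
  generalize q ^ ((i : ℤ) ^ 2 - ((p : ℤ) + 1) * i) = E
  generalize qFactInv ((p : ℤ) + 2 - i) = R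
  generalize qPochRatio (i + 1) = S
  generalize qPoch q (p + i) = Q
  generalize q ^ i = x at *
  generalize q ^ p = Y at *
  generalize (-1 : RatFunc ℚ) ^ i = s
  field_simp
  ring

/-- The normalised finite sum with a general parameter `p`. -/
noncomputable def truncGaussSum (p : ℕ) : RatFunc ℚ :=
  (1 - q * (q ^ p) ^ 2) * ∑ i ∈ range (p + 1), gaussTerm p i

lemma sum_gaussTerm_eq {p n : ℕ} (h : p + 1 ≤ n) :
    ∑ i ∈ range (p + 1), gaussTerm p i = ∑ i ∈ range n, gaussTerm p i := by
  refine sum_subset (range_subset_range.2 h) fun i _ hi => gaussTerm_of_lt ?_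
  rw [mem_range] at hi
  omega

lemma truncGaussSum_recurrence (p : ℕ) :
    (1 + q ^ 2 * q ^ p) * truncGaussSum p + q ^ p * (1 + q * q ^ p) * truncGaussSum (p + 2) =
      q ^ p * (1 - q) * truncGaussSum (p + 1) := by
  have h := sum_congr rfl fun i (_ : i ∈ range (p + 3)) => gaussTerm_telescope p i
  have hend : gaussCert p (p + 3) = 0 := by
    rw [gaussCert, qFactInv_of_neg (by push_cast; omega)]
    ring
  have hstart : gaussCert p 0 = 0 := by simp [gaussCert]
  rw [sum_sub_distrib, sum_add_distrib, ← mul_sum, ← mul_sum, ← mul_sum, ← mul_sum,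
    sum_range_sub, hend, hstart] at h
  rw [truncGaussSum, truncGaussSum, truncGaussSum, sum_gaussTerm_eq (n := p + 3) (by omega),
    sum_gaussTerm_eq (p := p + 1) (n := p + 3) (by omega)]
  linear_combination -h

lemma truncGaussSum_zero : truncGaussSum 0 = 1 := by
  have h := one_sub_q_pow_ne_zero 0
  simp only [zero_add, pow_one] at h
  simp [truncGaussSum, gaussTerm, qFactInv, qPochRatio, qPoch, h]

lemma truncGaussSum_one : truncGaussSum 1 = 1 := by
  have h1 := one_sub_q_pow_ne_zero 0
  have h2 := one_sub_q_pow_ne_zero 1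
  have h3 := one_sub_q_pow_ne_zero 2
  simp only [zero_add, pow_one, Nat.reduceAdd] at h1 h2 h3
  have h2' : 1 - q * q ≠ 0 := by rwa [← sq]
  have h3' : 1 - q * q ^ 2 ≠ 0 := by rwa [← pow_succ']
  simp [truncGaussSum, gaussTerm, qFactInv, qPochRatio, qPoch, sum_range_succ, prod_range_succ]
  field_simp
  ring

lemma truncGaussSum_eq (m : ℕ) :
    truncGaussSum (2 * m) = (-1) ^ m * q ^ (2 * (m : ℤ) - (m : ℤ) ^ 2) ∧
      truncGaussSum (2 * m + 1) = (-1) ^ m * q ^ (-(m : ℤ) ^ 2) := by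
  have hq := q_ne_zero
  induction m with
  | zero => simp [truncGaussSum_zero, truncGaussSum_one]
  | succ m ih =>
    obtain ⟨h0, h1⟩ := ih
    have hz : q ^ (2 * (m : ℤ) - (m : ℤ) ^ 2) = (q ^ m) ^ 2 * q ^ (-(m : ℤ) ^ 2) := by
      rw [← pow_mul, ← zpow_natCast, ← zpow_add₀ hq]
      congr 1
      push_cast
      ring
    have hz0 : q ^ (2 * ((m + 1 : ℕ) : ℤ) - ((m + 1 : ℕ) : ℤ) ^ 2) =
        q * q ^ (-(m : ℤ) ^ 2) := by
      rw [← zpow_one_add₀ hq]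
      congr 1
      push_cast
      ring
    have hz1 : q * (q ^ m) ^ 2 * q ^ (-((m + 1 : ℕ) : ℤ) ^ 2) = q ^ (-(m : ℤ) ^ 2) := by
      rw [← pow_mul, ← pow_succ', ← zpow_natCast, ← zpow_add₀ hq]
      congr 1
      push_cast
      ring
    have hx : q ^ m ≠ 0 := pow_ne_zero _ hq
    have n0 : 1 + q * (q ^ m) ^ 2 ≠ 0 := by
      convert one_add_q_pow_ne_zero (2 * m) using 2
      ring
    have n1 : 1 + q ^ 2 * (q ^ m) ^ 2 ≠ 0 := by
      convert one_add_q_pow_ne_zero (2 * m + 1) using 2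
      ring
    have rec0 := truncGaussSum_recurrence (2 * m)
    have rec1 := truncGaussSum_recurrence (2 * m + 1)
    rw [show q ^ (2 * m) = (q ^ m) ^ 2 by ring] at rec0
    rw [show q ^ (2 * m + 1) = q * (q ^ m) ^ 2 by ring, add_assoc (2 * m) 1 1] at rec1
    have k0 : truncGaussSum (2 * m + 2) = -(-1) ^ m * (q * q ^ (-(m : ℤ) ^ 2)) := by
      refine mul_left_cancel₀ (mul_ne_zero (pow_ne_zero 2 hx) n0) ?_
      rw [h0, h1, hz] at rec0
      linear_combination rec0
    rw [h1, k0] at rec1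
    refine ⟨?_, ?_⟩
    · rw [show 2 * (m + 1) = 2 * m + 2 by ring, k0, hz0]
      ring
    · refine mul_left_cancel₀ (mul_ne_zero (mul_ne_zero hq (pow_ne_zero 2 hx)) n1) ?_
      rw [show 2 * (m + 1) + 1 = 2 * m + 1 + 2 by ring, pow_succ]
      linear_combination rec1 + (1 + q ^ 2 * (q ^ m) ^ 2) * (-1) ^ m * hz1

/-- Theorem 2.2: a truncation of Gauss' square exponent theorem. -/
theorem truncated_gauss_sq_exponent_one (L : ℕ) (hL : 1 ≤ L) :
    ∑ k ∈ Finset.Icc (-(L : ℤ)) ((L : ℤ) - 1),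
      (-1 : RatFunc ℚ) ^ k * q ^ (k ^ 2) * qPochZ (-q) ((L : ℤ) - k - 1) *
        qbinom (3 * (L : ℤ) - k - 1) ((L : ℤ) + k) *
        ((1 - q ^ (4 * (L : ℤ) - 1)) / (1 - q ^ (3 * (L : ℤ) - k - 1))) = 1 := by
  have hq := q_ne_zero
  obtain ⟨m, rfl⟩ : ∃ m, L = m + 1 := ⟨L - 1, by omega⟩
  have hsum : (-1) ^ m * q ^ ((m : ℤ) ^ 2) * truncGaussSum (2 * m + 1) = 1 := by
    rw [(truncGaussSum_eq m).2, mul_mul_mul_comm, ← mul_pow, ← zpow_add₀ hq]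
    simp
  refine Eq.trans ?_ hsum
  rw [truncGaussSum, mul_sum, mul_sum]
  refine sum_bij' (fun k _ => ((m : ℤ) - k).toNat) (fun i _ => (m : ℤ) - i)
    ?_ ?_ ?_ ?_ ?_
  · intro k hk
    rw [mem_Icc] at hk
    rw [mem_range]
    omega
  · intro i hi
    rw [mem_range] at hi
    rw [mem_Icc]
    omega
  · intro k hk
    rw [mem_Icc] at hk
    push_cast at hk
    omega
  · intro i _
    omega
  · intro k hk
    rw [mem_Icc] at hk
    push_cast at hk
    obtain ⟨i, rfl⟩ : ∃ i : ℕ, k = (m : ℤ) - i := ⟨((m : ℤ) - k).toNat, by omega⟩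
    obtain ⟨d, hd⟩ : ∃ d : ℕ, 2 * m + 1 = i + d := ⟨2 * m + 1 - i, by omega⟩
    have a0 : ((m : ℤ) - ((m : ℤ) - i)).toNat = i := by omega
    have a1 : ((m + 1 : ℕ) : ℤ) - ((m : ℤ) - i) - 1 = (i : ℕ) := by push_cast; ring
    have a2 : 3 * ((m + 1 : ℕ) : ℤ) - ((m : ℤ) - i) - 1 = (2 * m + 1 + i + 1 : ℕ) := by
      push_cast; ring
    have a3 : ((m + 1 : ℕ) : ℤ) + ((m : ℤ) - i) = (d : ℕ) := by omega
    have a4 : 4 * ((m + 1 : ℕ) : ℤ) - 1 = (1 + (2 * m + 1) * 2 : ℕ) := by push_cast; ring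
    have a5 : ((2 * m + 1 + i + 1 : ℕ) : ℤ) - (d : ℕ) = (2 * i + 1 : ℕ) := by omega
    have a6 : ((2 * m + 1 : ℕ) : ℤ) - i = (d : ℕ) := by omega
    have sgn : (-1 : RatFunc ℚ) ^ ((m : ℤ) - i) = (-1) ^ m * (-1) ^ i := by
      rw [zpow_sub₀ (by norm_num), zpow_natCast, zpow_natCast, div_eq_mul_inv, ← inv_pow]
      norm_num
    have pw : q ^ (((m : ℤ) - i) ^ 2) = q ^ ((m : ℤ) ^ 2) *
        q ^ ((i : ℤ) ^ 2 - (((2 * m + 1 : ℕ) : ℤ) - 1) * i) := by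
      rw [← zpow_add₀ hq]
      congr 1
      push_cast
      ring
    have hz : qPochZ (-q) (i : ℕ) = qPoch (-q) i := by simp [qPochZ]
    have hb : qbinom (2 * m + 1 + i + 1 : ℕ) (d : ℕ) =
        qPoch q (2 * m + 1 + i) * (1 - q ^ (2 * m + 1 + i + 1)) /
          (qPoch q d * qPoch q (2 * i + 1)) := by
      rw [qbinom, if_pos (by omega), a5, Int.toNat_natCast, Int.toNat_natCast,
        Int.toNat_natCast, qPoch_succ q (2 * m + 1 + i), ← pow_succ']
    rw [a0, a1, a2, a3, a4, hz, hb, sgn, pw, gaussTerm, a6, qFactInv_natCast, qPochRatio,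
      zpow_natCast q (1 + (2 * m + 1) * 2), zpow_natCast q (2 * m + 1 + i + 1),
      ← pow_mul, ← pow_succ', add_comm 1 ((2 * m + 1) * 2)]
    have h0 := qPoch_q_ne_zero d
    have h1 := qPoch_q_ne_zero (2 * i + 1)
    have h2 := one_sub_q_pow_ne_zero (2 * m + 1 + i)
    generalize 1 - q ^ (2 * m + 1 + i + 1) = A at *
    generalize 1 - q ^ ((2 * m + 1) * 2 + 1) = B
    generalize qPoch q d = C at *
    generalize qPoch q (2 * i + 1) = D at *
    field_simp
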